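/- Let P be a graded poset of rank r and κ > 0. For 0 ≤ i ≤ r let g_i : F^B_κ(P) → R>0 be statistics such that g_i(π) depends only on the restriction of π to P_i (i.e., if π and π' agree on P_i then g_i(π) = g_i(π')), and set f = ∏_{i=0}^{r} g_i. If f is multiplicatively c-mesic for Rvac^B_F, i.e. f(π) · f(Rvac^B_F π) = c² for all π ∈ F^B_κ(P), then f is multiplicatively c-mesic for Row^B_F: for every π ∈ F^B_κ(P) and every m ≥ 1 with (Row^B_F)^m(π) = π, one has ∏_{k=0}^{m−1} f((Row^B_F)^k π) = c^m. -/

import Mathlib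

open scoped Classical

noncomputable section

/-- `P̂`: the poset `P` with a new minimum `0̂` and a new maximum `1̂` adjoined. -/
abbrev Phat (P : Type) := WithBot (WithTop P)

instance {P : Type} [Fintype P] : Fintype (Phat P) :=
  inferInstanceAs (Fintype (Option (Option P)))

/-- The inclusion of `P` into `P̂`. -/
def emb {P : Type} (p : P) : Phat P := ((p : WithTop P) : WithBot (WithTop P))

/-- The new maximum `1̂` of `P̂`. -/
def topHat (P : Type) : Phat P := ((⊤ : WithTop P) : WithBot (WithTop P))

variable {P : Type} [Fintype P] [PartialOrder P]

/-- `∑_{y ⋖ x} π(y)`. -/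
def covSumBelow (π : Phat P → ℝ) (x : Phat P) : ℝ :=
  ∑ y : Phat P, if y ⋖ x then π y else 0

/-- `∑_{x ⋖ y} 1/π(y)`. -/
def covSumAboveInv (π : Phat P → ℝ) (x : Phat P) : ℝ :=
  ∑ y : Phat P, if x ⋖ y then (π y)⁻¹ else 0

/-- The birational order-filter rank toggle `𝐭_i`, in simultaneous form (it agrees with the
composition of the pairwise commuting birational order filter toggles `t_p` over `p ∈ P_i`,
since a toggle `t_p` only changes the value at `p` and only reads values at `p` and at
elements covering or covered by `p`, which have different ranks). -/
def rankToggleB (rk : P → ℕ) (i : ℕ) (π : Phat P → ℝ) : Phat P → ℝ :=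
  fun x =>
    if ∃ p : P, rk p = i ∧ x = emb p then
      covSumBelow π x / (π x * covSumAboveInv π x)
    else π x

/-- Apply a word of rank toggles; the head of the list is applied last, matching the
convention that in a product `𝐭_{i_1} 𝐭_{i_2} ⋯ 𝐭_{i_k}` the rightmost factor acts first. -/
def applyB (rk : P → ℕ) : List ℕ → (Phat P → ℝ) → Phat P → ℝ
  | [] => fun π => π
  | i :: w => fun π => rankToggleB rk i (applyB rk w π)

/-- The word `𝐭_0 𝐭_1 ⋯ 𝐭_r` for rowmotion. -/
def rowWordB (r : ℕ) : List ℕ := List.range (r + 1)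

/-- The word `(𝐭_r)(𝐭_{r-1} 𝐭_r) ⋯ (𝐭_0 𝐭_1 ⋯ 𝐭_r)` for rowvacuation. -/
def rvacWordB (r : ℕ) : List ℕ :=
  (List.range (r + 1)).foldr (fun k acc => (List.range (r + 1)).drop (r - k) ++ acc) []

/-- The word `(𝐭_0)(𝐭_1 𝐭_0) ⋯ (𝐭_r 𝐭_{r-1} ⋯ 𝐭_0)` for dual rowvacuation. -/
def drvacWordB (r : ℕ) : List ℕ :=
  (List.range (r + 1)).foldr (fun k acc => (List.range (k + 1)).reverse ++ acc) []

/-- Birational order filter rowmotion `Row^B_F = 𝐭_0 𝐭_1 ⋯ 𝐭_r`. -/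
def RowB (rk : P → ℕ) (r : ℕ) : (Phat P → ℝ) → Phat P → ℝ := applyB rk (rowWordB r)

/-- The inverse of birational order filter rowmotion, `(Row^B_F)⁻¹ = 𝐭_r ⋯ 𝐭_1 𝐭_0`
(each toggle is an involution, so the reversed word gives the inverse map). -/
def RowInvB (rk : P → ℕ) (r : ℕ) : (Phat P → ℝ) → Phat P → ℝ := applyB rk (rowWordB r).reverse

/-- Birational order filter rowvacuation `Rvac^B_F`. -/
def RvacB (rk : P → ℕ) (r : ℕ) : (Phat P → ℝ) → Phat P → ℝ := applyB rk (rvacWordB r)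

/-- Birational order filter dual rowvacuation `DRvac^B_F`. -/
def DRvacB (rk : P → ℕ) (r : ℕ) : (Phat P → ℝ) → Phat P → ℝ := applyB rk (drvacWordB r)

end

section RowvacuationLemmas

variable {P : Type}

/-- Membership in `F^B_κ(P)`: positive labellings with the prescribed values at `0̂` and `1̂`. -/
def IsLabelling (κ : ℝ) (π : Phat P → ℝ) : Prop :=
  (∀ x, 0 < π x) ∧ π ⊥ = 1 ∧ π (topHat P) = κ

lemma bot_ne_emb (p : P) : (⊥ : Phat P) ≠ emb p := WithBot.bot_ne_coe

lemma topHat_ne_emb (p : P) : topHat P ≠ emb p := by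
  simp [topHat, emb]

lemma emb_injective : Function.Injective (emb : P → Phat P) := fun p q h => by
  simpa [emb] using h

lemma Phat.cases (x : Phat P) : x = ⊥ ∨ x = topHat P ∨ ∃ p, x = emb p := by
  induction x using WithBot.recBotCoe with
  | bot => exact Or.inl rfl
  | coe x =>
    induction x using WithTop.recTopCoe with
    | top => exact Or.inr (Or.inl rfl)
    | coe p => exact Or.inr (Or.inr ⟨p, rfl⟩)

variable [PartialOrder P]

lemma emb_lt_emb {p q : P} : emb p < emb q ↔ p < q := by
  simp [emb]

lemma covBy_of_emb_covBy {p q : P} (h : emb p ⋖ emb q) : p ⋖ q :=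
  ⟨emb_lt_emb.1 h.1, fun _ h₁ h₂ => h.2 (emb_lt_emb.2 h₁) (emb_lt_emb.2 h₂)⟩

variable [Fintype P]

lemma covSumBelow_pos {π : Phat P → ℝ} (hπ : ∀ x, 0 < π x) (p : P) :
    0 < covSumBelow π (emb p) := by
  obtain ⟨y, -, hy⟩ := exists_le_covBy_of_lt (WithBot.bot_lt_coe (p : WithTop P))
  refine Finset.sum_pos' (fun x _ => ?_) ⟨y, Finset.mem_univ _, ?_⟩
  · split_ifs
    exacts [(hπ x).le, le_rfl]
  · rw [if_pos (show y ⋖ emb p from hy)]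
    exact hπ y

lemma covSumAboveInv_pos {π : Phat P → ℝ} (hπ : ∀ x, 0 < π x) (p : P) :
    0 < covSumAboveInv π (emb p) := by
  have hlt : emb p < topHat P := WithBot.coe_lt_coe.2 (WithTop.coe_lt_top p)
  obtain ⟨y, hy, -⟩ := exists_covBy_le_of_lt hlt
  refine Finset.sum_pos' (fun x _ => ?_) ⟨y, Finset.mem_univ _, ?_⟩
  · split_ifs
    exacts [(inv_pos.2 (hπ x)).le, le_rfl]
  · rw [if_pos hy]
    exact inv_pos.2 (hπ y)

lemma rankToggleB_emb_of_ne (rk : P → ℕ) {i : ℕ} (π : Phat P → ℝ) {p : P} (h : rk p ≠ i) :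
    rankToggleB rk i π (emb p) = π (emb p) := by
  refine if_neg ?_
  rintro ⟨q, hq, hpq⟩
  exact h (emb_injective hpq ▸ hq)

lemma rankToggleB_emb (rk : P → ℕ) (π : Phat P → ℝ) (p : P) :
    rankToggleB rk (rk p) π (emb p) =
      covSumBelow π (emb p) / (π (emb p) * covSumAboveInv π (emb p)) :=
  if_pos ⟨p, rfl, rfl⟩

lemma rankToggleB_bot (rk : P → ℕ) (i : ℕ) (π : Phat P → ℝ) : rankToggleB rk i π ⊥ = π ⊥ :=
  if_neg fun ⟨p, _, hp⟩ => bot_ne_emb p hp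

lemma rankToggleB_topHat (rk : P → ℕ) (i : ℕ) (π : Phat P → ℝ) :
    rankToggleB rk i π (topHat P) = π (topHat P) :=
  if_neg fun ⟨p, _, hp⟩ => topHat_ne_emb p hp

lemma IsLabelling.rankToggleB {κ : ℝ} {π : Phat P → ℝ} (h : IsLabelling κ π) (rk : P → ℕ)
    (i : ℕ) : IsLabelling κ (rankToggleB rk i π) := by
  refine ⟨fun x => ?_, (rankToggleB_bot rk i π).trans h.2.1,
    (rankToggleB_topHat rk i π).trans h.2.2⟩
  unfold _root_.rankToggleB
  split_ifs with hx
  · obtain ⟨p, -, rfl⟩ := hx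
    exact div_pos (covSumBelow_pos h.1 p) (mul_pos (h.1 _) (covSumAboveInv_pos h.1 p))
  · exact h.1 x

lemma IsLabelling.applyB {κ : ℝ} {π : Phat P → ℝ} (h : IsLabelling κ π) (rk : P → ℕ)
    (w : List ℕ) : IsLabelling κ (applyB rk w π) := by
  induction w with
  | nil => exact h
  | cons i w ih => exact ih.rankToggleB rk i

lemma IsLabelling.iterate_rowB {κ : ℝ} {π : Phat P → ℝ} (h : IsLabelling κ π) (rk : P → ℕ)
    (r k : ℕ) : IsLabelling κ ((RowB rk r)^[k] π) := by
  induction k with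
  | zero => exact h
  | succ k ih =>
    rw [Function.iterate_succ_apply']
    exact ih.applyB rk _

lemma applyB_append (rk : P → ℕ) (v w : List ℕ) (π : Phat P → ℝ) :
    applyB rk (v ++ w) π = applyB rk v (applyB rk w π) := by
  induction v with
  | nil => rfl
  | cons i v ih => exact congrArg (rankToggleB rk i) ih

lemma applyB_emb_of_notMem (rk : P → ℕ) {w : List ℕ} (π : Phat P → ℝ) {p : P} (h : rk p ∉ w) :
    applyB rk w π (emb p) = π (emb p) := by
  induction w with
  | nil => rfl
  | cons i w ih =>
    rw [List.mem_cons, not_or] at h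
    exact (rankToggleB_emb_of_ne rk _ h.1).trans (ih h.2)

/-- Two labellings agree at `0̂`, at `1̂` and on all ranks `≥ k - 1`. -/
def AgreeAbove (rk : P → ℕ) (k : ℕ) (π π' : Phat P → ℝ) : Prop :=
  π ⊥ = π' ⊥ ∧ π (topHat P) = π' (topHat P) ∧ ∀ p : P, k ≤ rk p + 1 → π (emb p) = π' (emb p)

lemma AgreeAbove.rankToggleB {rk : P → ℕ} (hcov : ∀ x y : P, x ⋖ y → rk y = rk x + 1)
    {k i : ℕ} (hki : k ≤ i) {π π' : Phat P → ℝ} (h : AgreeAbove rk k π π') :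
    AgreeAbove rk k (rankToggleB rk i π) (rankToggleB rk i π') := by
  obtain ⟨hb, ht, hp⟩ := h
  refine ⟨by simpa only [rankToggleB_bot] using hb, by simpa only [rankToggleB_topHat] using ht,
    fun p hkp => ?_⟩
  by_cases hpi : rk p = i
  · subst hpi
    have hbelow : covSumBelow π (emb p) = covSumBelow π' (emb p) := by
      refine Finset.sum_congr rfl fun y _ => ?_
      split_ifs with hy
      · obtain rfl | rfl | ⟨q, rfl⟩ := Phat.cases y
        · exact hb
        · exact ht
        · have := hcov _ _ (covBy_of_emb_covBy hy)
          exact hp q (by omega)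
      · rfl
    have habove : covSumAboveInv π (emb p) = covSumAboveInv π' (emb p) := by
      refine Finset.sum_congr rfl fun y _ => ?_
      split_ifs with hy
      · obtain rfl | rfl | ⟨q, rfl⟩ := Phat.cases y
        · rw [hb]
        · rw [ht]
        · have := hcov _ _ (covBy_of_emb_covBy hy)
          rw [hp q (by omega)]
      · rfl
    rw [rankToggleB_emb, rankToggleB_emb, hbelow, habove, hp p hkp]
  · rw [rankToggleB_emb_of_ne rk _ hpi, rankToggleB_emb_of_ne rk _ hpi, hp p hkp]

lemma AgreeAbove.applyB {rk : P → ℕ} (hcov : ∀ x y : P, x ⋖ y → rk y = rk x + 1)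
    {k : ℕ} {w : List ℕ} (hw : ∀ i ∈ w, k ≤ i) {π π' : Phat P → ℝ} (h : AgreeAbove rk k π π') :
    AgreeAbove rk k (applyB rk w π) (applyB rk w π') := by
  induction w with
  | nil => exact h
  | cons i w ih =>
    exact (ih fun j hj => hw j (List.mem_cons_of_mem _ hj)).rankToggleB hcov
      (hw i List.mem_cons_self)

lemma le_of_mem_drop_range {n m i : ℕ} (h : i ∈ (List.range n).drop m) : m ≤ i := by
  obtain ⟨j, hj, rfl⟩ := List.mem_iff_getElem.1 h
  simp

lemma lt_of_mem_take_range {n m i : ℕ} (h : i ∈ (List.range n).take m) : i < m := by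
  obtain ⟨j, hj, rfl⟩ := List.mem_iff_getElem.1 h
  simp at hj ⊢
  omega

/-- The last `m` factors (those acting first) of the rowvacuation word. -/
def rvacPartialWord (r m : ℕ) : List ℕ :=
  (List.range m).foldr (fun k acc => (List.range (r + 1)).drop (m - 1 - k) ++ acc) []

lemma rvacPartialWord_succ (r m : ℕ) :
    rvacPartialWord r (m + 1) = (List.range (r + 1)).drop m ++ rvacPartialWord r m := by
  rw [rvacPartialWord, List.range_succ_eq_map (n := m), List.foldr_cons, List.foldr_map]
  simp only [Nat.add_sub_cancel, Nat.sub_zero, Nat.succ_eq_add_one, Nat.sub_sub, Nat.add_comm 1,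
    rvacPartialWord]

lemma applyB_rvacPartialWord {rk : P → ℕ} (hcov : ∀ x y : P, x ⋖ y → rk y = rk x + 1)
    {κ : ℝ} {π : Phat P → ℝ} (hπ : IsLabelling κ π) (r m : ℕ) (p : P) :
    applyB rk (rvacPartialWord r m) π (emb p) =
      (RowB rk r)^[min m (rk p + 1)] π (emb p) := by
  induction m generalizing p with
  | zero => simp [rvacPartialWord, applyB]
  | succ m ih =>
    rw [rvacPartialWord_succ, applyB_append]
    rcases lt_or_ge (rk p) m with hpm | hpm
    · rw [applyB_emb_of_notMem rk _ fun h => hpm.not_ge (le_of_mem_drop_range h), ih p,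
        min_eq_right (by omega), min_eq_right (by omega)]
    · have hagree : AgreeAbove rk m (applyB rk (rvacPartialWord r m) π) ((RowB rk r)^[m] π) := by
        refine ⟨?_, ?_, fun q hq => ?_⟩
        · rw [(hπ.applyB rk _).2.1, (hπ.iterate_rowB rk r m).2.1]
        · rw [(hπ.applyB rk _).2.2, (hπ.iterate_rowB rk r m).2.2]
        · rw [ih q, min_eq_left hq]
      have hdrop := (hagree.applyB hcov (w := (List.range (r + 1)).drop m)
        fun _ => le_of_mem_drop_range).2.2 p (by omega)
      have hrow : ∀ σ, RowB rk r σ = applyB rk ((List.range (r + 1)).take m)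
          (applyB rk ((List.range (r + 1)).drop m) σ) := fun σ => by
        rw [← applyB_append, List.take_append_drop]
        rfl
      rw [min_eq_left (by omega), Function.iterate_succ_apply', hrow, hdrop,
        applyB_emb_of_notMem rk _ fun h => hpm.not_gt (lt_of_mem_take_range h)]

/-- On rank `i`, rowvacuation agrees with the `(i + 1)`-st power of rowmotion. -/
lemma rvacB_emb {rk : P → ℕ} (hcov : ∀ x y : P, x ⋖ y → rk y = rk x + 1)
    {κ : ℝ} {π : Phat P → ℝ} (hπ : IsLabelling κ π) {r : ℕ} {p : P} (hp : rk p ≤ r) :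
    RvacB rk r π (emb p) = (RowB rk r)^[rk p + 1] π (emb p) := by
  have h := applyB_rvacPartialWord hcov hπ r (r + 1) p
  rwa [min_eq_right (by omega)] at h

end RowvacuationLemmas

lemma prod_range_add_of_periodic {M : Type*} [CommMonoid M] {h : ℕ → M} {m : ℕ}
    (hper : ∀ k, h (k + m) = h k) (j : ℕ) :
    ∏ k ∈ Finset.range m, h (k + j) = ∏ k ∈ Finset.range m, h k := by
  induction j with
  | zero => rfl
  | succ j ih =>
    rw [← ih]
    cases m with
    | zero => rfl
    | succ m =>
      rw [Finset.prod_range_succ, Finset.prod_range_succ', ← hper (0 + j)]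
      congr 1
      · exact Finset.prod_congr rfl fun k _ => congrArg h (by omega)
      · exact congrArg h (by omega)

/-- transfer of homomesies from rowvacuation to rowmotion.
Let `P` be a graded poset of rank `r` and `κ > 0`.  For `0 ≤ i ≤ r` let
`g i : F^B_κ(P) → ℝ>0` be statistics depending only on the restriction to the `i`-th rank,
and let `f = ∏_{i=0}^r g i`.  If `f(π)·f(Rvac^B_F π) = c²` for all `π ∈ F^B_κ(P)`, then
`f` is multiplicatively `c`-mesic for `Row^B_F`: along every finite `Row^B_F`-orbit the
product of the values of `f` is `c^m`, where `m` is the size of the orbit. -/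
theorem stmt6 {P : Type} [Fintype P] [PartialOrder P] [Nonempty P]
    (r : ℕ) (rk : P → ℕ)
    (hmin : ∀ x : P, IsMin x → rk x = 0)
    (hcov : ∀ x y : P, x ⋖ y → rk y = rk x + 1)
    (hmax : ∀ x : P, IsMax x → rk x = r)
    (κ : ℝ) (hκ : 0 < κ) (c : ℝ) (hc : 0 < c)
    (g : ℕ → (Phat P → ℝ) → ℝ)
    (hdep : ∀ i, i ≤ r → ∀ π π' : Phat P → ℝ,
      (∀ p : P, rk p = i → π (emb p) = π' (emb p)) → g i π = g i π')
    (hgpos : ∀ i, i ≤ r → ∀ π : Phat P → ℝ,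
      (∀ x, 0 < π x) → π ⊥ = 1 → π (topHat P) = κ → 0 < g i π)
    (hmesic : ∀ π : Phat P → ℝ, (∀ x, 0 < π x) → π ⊥ = 1 → π (topHat P) = κ →
      (∏ i ∈ Finset.range (r + 1), g i π) *
        (∏ i ∈ Finset.range (r + 1), g i (RvacB rk r π)) = c ^ 2) :
    ∀ π : Phat P → ℝ, (∀ x, 0 < π x) → π ⊥ = 1 → π (topHat P) = κ →
      ∀ m : ℕ, 1 ≤ m → (RowB rk r)^[m] π = π →
        ∏ k ∈ Finset.range m,
          (∏ i ∈ Finset.range (r + 1), g i ((RowB rk r)^[k] π)) = c ^ m := by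
  intro π hpos hbot htop m _ hm
  have hlab (k : ℕ) : IsLabelling κ ((RowB rk r)^[k] π) :=
    IsLabelling.iterate_rowB ⟨hpos, hbot, htop⟩ rk r k
  have hrvac (k i : ℕ) (hi : i ≤ r) :
      g i (RvacB rk r ((RowB rk r)^[k] π)) = g i ((RowB rk r)^[k + (i + 1)] π) := by
    refine hdep i hi _ _ fun p hp => ?_
    subst hp
    rw [rvacB_emb hcov (hlab k) hi, ← Function.iterate_add_apply, add_comm]
  have hperiodic (i k : ℕ) : g i ((RowB rk r)^[k + m] π) = g i ((RowB rk r)^[k] π) := by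
    rw [Function.iterate_add_apply, hm]
  have hshift : ∏ k ∈ Finset.range m, ∏ i ∈ Finset.range (r + 1),
      g i (RvacB rk r ((RowB rk r)^[k] π)) =
      ∏ k ∈ Finset.range m, ∏ i ∈ Finset.range (r + 1), g i ((RowB rk r)^[k] π) := by
    rw [Finset.prod_comm, Finset.prod_comm (s := Finset.range m)]
    refine Finset.prod_congr rfl fun i hi => ?_
    exact (Finset.prod_congr rfl fun k _ => hrvac k i (Finset.mem_range_succ_iff.1 hi)).trans
      (prod_range_add_of_periodic (h := fun k => g i ((RowB rk r)^[k] π)) (hperiodic i) (i + 1))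
  have hsq : (∏ k ∈ Finset.range m, ∏ i ∈ Finset.range (r + 1), g i ((RowB rk r)^[k] π)) ^ 2 =
      (c ^ m) ^ 2 := by
    calc _ = ∏ k ∈ Finset.range m, ((∏ i ∈ Finset.range (r + 1), g i ((RowB rk r)^[k] π)) *
          ∏ i ∈ Finset.range (r + 1), g i (RvacB rk r ((RowB rk r)^[k] π))) := by
          rw [Finset.prod_mul_distrib, hshift, sq]
      _ = ∏ _k ∈ Finset.range m, c ^ 2 :=
          Finset.prod_congr rfl fun k _ => hmesic _ (hlab k).1 (hlab k).2.1 (hlab k).2.2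
      _ = (c ^ m) ^ 2 := by
          rw [Finset.prod_const, Finset.card_range, pow_right_comm]
  refine (pow_left_inj₀ (Finset.prod_nonneg fun k _ => Finset.prod_nonneg fun i hi => ?_)
    (pow_nonneg hc.le m) two_ne_zero).1 hsq
  exact (hgpos i (Finset.mem_range_succ_iff.1 hi) _ (hlab k).1 (hlab k).2.1 (hlab k).2.2).le
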